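/- arXiv:1509.04461 — 4 statements merged into one kernel-verified Lean document; each statement's English description precedes it below -/
import Mathlib

section
/- Let d ≥ 1, let U₀ ⊆ ℝ^d be an open neighborhood of 0, let h : ℝ^d → ℝ be continuous on U₀ and vanish to infinite order at 0, and let κ ⊆ U₀ be compact. Then for every N ∈ ℕ there is a constant C > 0 such that for all λ ≥ 1 and all x ∈ κ, |h(x)| · exp(-λ ‖x‖² / 2) ≤ C · λ^{-N}. -/
/-- A function bounded on a compact set and `O(‖x‖ ^ m)` near `0` is bounded by a multiple of
`‖x‖ ^ m` on the whole set. -/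
theorem exists_abs_le_mul_norm_pow {E : Type*} [NormedAddCommGroup E] {h : E → ℝ} {κ : Set E}
    (hκ : IsCompact κ) (hc : ContinuousOn h κ) {m : ℕ} {A δ : ℝ} (hA : 0 < A) (hδ : 0 < δ)
    (hh : ∀ x, ‖x‖ ≤ δ → |h x| ≤ A * ‖x‖ ^ m) :
    ∃ K > 0, ∀ x ∈ κ, |h x| ≤ K * ‖x‖ ^ m := by
  obtain ⟨M, hM⟩ := hκ.exists_bound_of_continuousOn hc
  refine ⟨A + |M| / δ ^ m, by positivity, fun x hx => ?_⟩
  rw [add_mul]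
  rcases le_total ‖x‖ δ with hxδ | hxδ
  · have : 0 ≤ |M| / δ ^ m * ‖x‖ ^ m := by positivity
    linarith [hh x hxδ]
  · have h₁ : |M| ≤ |M| / δ ^ m * ‖x‖ ^ m := by
      calc |M| = |M| / δ ^ m * δ ^ m := by field_simp
        _ ≤ |M| / δ ^ m * ‖x‖ ^ m := by gcongr
    have h₂ : |h x| ≤ |M| := (hM x hx).trans (le_abs_self M)
    have : 0 ≤ A * ‖x‖ ^ m := by positivity
    linarith

theorem pow_mul_exp_neg_le_factorial {t : ℝ} (ht : 0 ≤ t) (n : ℕ) :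
    t ^ n * Real.exp (-t) ≤ n.factorial := by
  have h := Real.pow_div_factorial_le_exp t ht n
  rw [div_le_iff₀ (by positivity)] at h
  rw [Real.exp_neg, ← div_eq_mul_inv, div_le_iff₀ (Real.exp_pos t)]
  linarith

/-- Let `d ≥ 1`, let `U₀ ⊆ ℝ^d` be an open neighborhood of `0`, let `h : ℝ^d → ℝ` be
continuous on `U₀` and vanish to infinite order at `0` (i.e. for every positive integer `m`
there are `C_m > 0`, `δ_m > 0` with `|h x| ≤ C_m ‖x‖^m` for `‖x‖ ≤ δ_m`), and let `κ ⊆ U₀`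
be compact.  Then for every `N` there is `C > 0` such that for all `λ ≥ 1` and `x ∈ κ`,
`|h x| · exp(-λ ‖x‖²/2) ≤ C · λ^{-N}`. -/
theorem stmt_1 (d : ℕ) (hd : 1 ≤ d)
    (U₀ : Set (EuclideanSpace ℝ (Fin d))) (hU₀ : IsOpen U₀)
    (h0 : (0 : EuclideanSpace ℝ (Fin d)) ∈ U₀)
    (h : EuclideanSpace ℝ (Fin d) → ℝ) (hc : ContinuousOn h U₀)
    (hflat : ∀ m : ℕ, 0 < m → ∃ C > (0 : ℝ), ∃ δ > (0 : ℝ),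
      ∀ x : EuclideanSpace ℝ (Fin d), ‖x‖ ≤ δ → |h x| ≤ C * ‖x‖ ^ m)
    (κ : Set (EuclideanSpace ℝ (Fin d))) (hκ : IsCompact κ) (hκU : κ ⊆ U₀) :
    ∀ N : ℕ, ∃ C > (0 : ℝ), ∀ lam : ℝ, 1 ≤ lam → ∀ x ∈ κ,
      |h x| * Real.exp (-lam * ‖x‖ ^ 2 / 2) ≤ C * lam ^ (-(N : ℝ)) := by
  intro N
  obtain ⟨A, hA, δ, hδ, hh⟩ := hflat (2 * (N + 1)) (by positivity)
  obtain ⟨K, hK, hKκ⟩ := exists_abs_le_mul_norm_pow hκ (hc.mono hκU) hA hδ hh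
  refine ⟨K * 2 ^ (N + 1) * (N + 1).factorial, by positivity, fun lam hlam x hx => ?_⟩
  have hlam₀ : 0 < lam := by linarith
  rw [Real.rpow_neg hlam₀.le, Real.rpow_natCast, ← div_eq_mul_inv, le_div_iff₀ (by positivity)]
  set t := lam * ‖x‖ ^ 2 / 2 with ht
  have ht₀ : 0 ≤ t := by positivity
  have hexp : -lam * ‖x‖ ^ 2 / 2 = -t := by rw [ht]; ring
  rw [hexp]
  calc |h x| * Real.exp (-t) * lam ^ N
      ≤ K * ‖x‖ ^ (2 * (N + 1)) * Real.exp (-t) * lam ^ (N + 1) := by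
        gcongr
        · exact hKκ x hx
        · exact N.le_succ
    _ = K * (lam * ‖x‖ ^ 2) ^ (N + 1) * Real.exp (-t) := by rw [pow_mul, mul_pow]; ring
    _ = K * 2 ^ (N + 1) * (t ^ (N + 1) * Real.exp (-t)) := by
        rw [show lam * ‖x‖ ^ 2 = 2 * t by rw [ht]; ring, mul_pow]; ring
    _ ≤ K * 2 ^ (N + 1) * (N + 1).factorial := by
        gcongr
        exact pow_mul_exp_neg_le_factorial ht₀ (N + 1)
end

section
/- Let d ≥ 1, δ ≥ δ₀ > 0, and let χ : ℝ^d → ℝ be continuous with 0 ≤ χ ≤ 1, χ(x) = 1 for ‖x‖ ≤ δ₀, and χ(x) = 0 for ‖x‖ ≥ δ. Let r : ℝ^d → ℝ be continuous with |r(x)| ≤ C ‖x‖³ for ‖x‖ ≤ δ, where C δ ≤ 1. Then there exist c > 0 and λ₀ ≥ 1 such that for every λ ≥ λ₀, ∫_{ℝ^d} χ(x)² · exp(λ(-2‖x‖² + r(x))) dx ≥ c · λ^{-d/2}. -/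
open MeasureTheory

/-- Real-phase Gaussian lower bound: with a cut-off `χ` equal to `1` on `‖x‖ ≤ δ₀` and
supported in `‖x‖ ≤ δ`, and a continuous perturbation `r` with `|r x| ≤ C‖x‖³` for
`‖x‖ ≤ δ` and `Cδ ≤ 1`, there are `c > 0` and `λ₀ ≥ 1` such that
`∫ χ² e^{λ(-2‖x‖² + r(x))} dx ≥ c λ^{-d/2}` for all `λ ≥ λ₀`. -/
theorem stmt_6 (d : ℕ) (hd : 1 ≤ d) (δ δ₀ : ℝ) (hδ₀ : 0 < δ₀) (hδ : δ₀ ≤ δ)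
    (χ : EuclideanSpace ℝ (Fin d) → ℝ) (hχc : Continuous χ)
    (hχ01 : ∀ x, 0 ≤ χ x ∧ χ x ≤ 1)
    (hχ1 : ∀ x : EuclideanSpace ℝ (Fin d), ‖x‖ ≤ δ₀ → χ x = 1)
    (hχ0 : ∀ x : EuclideanSpace ℝ (Fin d), δ ≤ ‖x‖ → χ x = 0)
    (r : EuclideanSpace ℝ (Fin d) → ℝ) (hrc : Continuous r)
    (C : ℝ) (hr : ∀ x : EuclideanSpace ℝ (Fin d), ‖x‖ ≤ δ → |r x| ≤ C * ‖x‖ ^ 3)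
    (hCδ : C * δ ≤ 1) :
    ∃ c > (0 : ℝ), ∃ lam₀ ≥ (1 : ℝ), ∀ lam : ℝ, lam₀ ≤ lam →
      c * lam ^ (-(d : ℝ) / 2) ≤
        ∫ x : EuclideanSpace ℝ (Fin d), χ x ^ 2 * Real.exp (lam * (-2 * ‖x‖ ^ 2 + r x)) := by
  have hb : 0 < volume.real (Metric.ball (0 : EuclideanSpace ℝ (Fin d)) 1) :=
    ENNReal.toReal_pos (Metric.measure_ball_pos volume _ one_pos).ne' measure_ball_lt_top.ne
  refine ⟨Real.exp (-3 * δ₀ ^ 2) * (δ₀ ^ d *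
    volume.real (Metric.ball (0 : EuclideanSpace ℝ (Fin d)) 1)), by positivity, 1, le_rfl,
    fun lam hlam => ?_⟩
  have hlam0 : 0 < lam := by linarith
  have hsqrt : 1 ≤ √lam := Real.one_le_sqrt.mpr hlam
  have hsqrt0 : 0 < √lam := by linarith
  set ρ : ℝ := δ₀ / √lam with hρ
  have hρ0 : 0 < ρ := by positivity
  have hρle : ρ ≤ δ₀ := div_le_self hδ₀.le hsqrt
  have hρsq : lam * ρ ^ 2 = δ₀ ^ 2 := by
    rw [hρ, div_pow, Real.sq_sqrt hlam0.le]
    field_simp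
  have hint : Integrable (fun x : EuclideanSpace ℝ (Fin d) =>
      χ x ^ 2 * Real.exp (lam * (-2 * ‖x‖ ^ 2 + r x))) := by
    refine Continuous.integrable_of_hasCompactSupport (by fun_prop) ?_
    refine HasCompactSupport.intro (isCompact_closedBall 0 δ) fun x hx => ?_
    have hx' : δ ≤ ‖x‖ := by
      rw [mem_closedBall_zero_iff, not_le] at hx
      exact hx.le
    simp [hχ0 x hx']
  have hlower : ∀ x ∈ Metric.ball (0 : EuclideanSpace ℝ (Fin d)) ρ,
      Real.exp (-3 * δ₀ ^ 2) ≤ χ x ^ 2 * Real.exp (lam * (-2 * ‖x‖ ^ 2 + r x)) := by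
    intro x hx
    rw [mem_ball_zero_iff] at hx
    have hn := norm_nonneg x
    have hxδ : ‖x‖ ≤ δ := by linarith
    rw [hχ1 x (by linarith), one_pow, one_mul]
    refine Real.exp_le_exp.mpr ?_
    have hC : C * ‖x‖ ≤ 1 := by
      rcases le_total 0 C with h | h
      · exact (mul_le_mul_of_nonneg_left hxδ h).trans hCδ
      · exact (mul_nonpos_of_nonpos_of_nonneg h hn).trans zero_le_one
    have hr3 : C * ‖x‖ ^ 3 ≤ ‖x‖ ^ 2 := by
      calc C * ‖x‖ ^ 3 = (C * ‖x‖) * ‖x‖ ^ 2 := by ring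
        _ ≤ 1 * ‖x‖ ^ 2 := by gcongr
        _ = ‖x‖ ^ 2 := one_mul _
    have hrl : -(‖x‖ ^ 2) ≤ r x := by
      linarith [neg_abs_le (r x), hr x hxδ]
    have hsq : lam * ‖x‖ ^ 2 ≤ δ₀ ^ 2 := by
      rw [← hρsq]
      gcongr
    have := mul_le_mul_of_nonneg_left hrl hlam0.le
    linarith
  have hpow : lam ^ (-(d : ℝ) / 2) = ((√lam) ^ d)⁻¹ := by
    rw [Real.sqrt_eq_rpow, ← Real.rpow_mul_natCast hlam0.le, ← Real.rpow_neg hlam0.le]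
    congr 1
    ring
  have hvol : volume.real (Metric.ball (0 : EuclideanSpace ℝ (Fin d)) ρ) =
      ρ ^ d * volume.real (Metric.ball (0 : EuclideanSpace ℝ (Fin d)) 1) := by
    rw [Measure.real, Measure.addHaar_ball_of_pos _ _ hρ0, ENNReal.toReal_mul,
      ENNReal.toReal_ofReal (by positivity), finrank_euclideanSpace_fin, Measure.real]
  calc _ = Real.exp (-3 * δ₀ ^ 2) *
        volume.real (Metric.ball (0 : EuclideanSpace ℝ (Fin d)) ρ) := by
        rw [hvol, hpow, hρ, div_pow]
        ring
    _ ≤ ∫ x in Metric.ball (0 : EuclideanSpace ℝ (Fin d)) ρ,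
        χ x ^ 2 * Real.exp (lam * (-2 * ‖x‖ ^ 2 + r x)) :=
        setIntegral_ge_of_const_le_real measurableSet_ball measure_ball_lt_top.ne hlower
          hint.integrableOn
    _ ≤ _ := setIntegral_le_integral hint (Filter.Eventually.of_forall fun x => by positivity)
end

section
/- Let d ≥ 1, δ ≥ δ₀ > 0, and let χ : ℝ^d → ℝ be continuous with 0 ≤ χ ≤ 1, χ(x) = 1 for ‖x‖ ≤ δ₀, and χ(x) = 0 for ‖x‖ ≥ δ. Let r : ℝ^d → ℂ be continuous with |r(x)| ≤ C ‖x‖³ for ‖x‖ ≤ δ, where C δ ≤ 1. Then there exist c > 0 and λ₀ ≥ 1 such that for every λ ≥ λ₀, |∫_{ℝ^d} χ(x)² · exp(λ(-2‖x‖² + r(x))) dx| ≥ c · λ^{-d/2}. -/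
open MeasureTheory

open Filter Topology

theorem integrable_exp_neg_mul_sq_norm {V : Type*} [NormedAddCommGroup V] [InnerProductSpace ℝ V]
    [FiniteDimensional ℝ V] [MeasurableSpace V] [BorelSpace V] {b : ℝ} (hb : 0 < b) :
    Integrable (fun v : V => Real.exp (-b * ‖v‖ ^ 2)) := by
  have h := (GaussianFourier.integrable_cexp_neg_mul_sq_norm_add (V := V) (b := (b : ℂ))
    (by simpa using hb) 0 0).norm
  refine h.congr (Eventually.of_forall fun v => ?_)
  simp only [Complex.norm_exp]
  congr 1
  simp [← Complex.ofReal_pow]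

/-- The integral of a function is recovered from the integral of its rescaling. -/
theorem integral_eq_pow_smul_integral_comp_smul {V F : Type*} [NormedAddCommGroup V]
    [NormedSpace ℝ V] [FiniteDimensional ℝ V] [MeasurableSpace V] [BorelSpace V]
    [NormedAddCommGroup F] [NormedSpace ℝ F] (μ : Measure V) [μ.IsAddHaarMeasure]
    (f : V → F) {s : ℝ} (hs : 0 < s) :
    ∫ x, f x ∂μ = s ^ Module.finrank ℝ V • ∫ x, f (s • x) ∂μ := by
  rw [Measure.integral_comp_smul, abs_of_nonneg (by positivity), smul_inv_smul₀ (by positivity)]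

/-- A remainder that is cubic on a ball is dominated there by the square of the norm. -/
theorem norm_le_sq_of_le_cube {V F : Type*} [NormedAddCommGroup V] [NormedAddCommGroup F]
    {r : V → F} {C δ : ℝ} (hr : ∀ x, ‖x‖ ≤ δ → ‖r x‖ ≤ C * ‖x‖ ^ 3) (hCδ : C * δ ≤ 1)
    {x : V} (hx : ‖x‖ ≤ δ) : ‖r x‖ ≤ ‖x‖ ^ 2 := by
  have h1 : C * ‖x‖ ≤ 1 := by
    rcases le_total 0 C with hC | hC
    · exact (mul_le_mul_of_nonneg_left hx hC).trans hCδ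
    · nlinarith [norm_nonneg x]
  nlinarith [hr x hx, sq_nonneg ‖x‖]

/-- A function with cubic decay at the origin is negligible after parabolic rescaling. -/
theorem tendsto_inv_sq_mul_comp_smul {V : Type*} [NormedAddCommGroup V] [NormedSpace ℝ V]
    {r : V → ℂ} {C δ : ℝ} (hδ : 0 < δ) (hr : ∀ x, ‖x‖ ≤ δ → ‖r x‖ ≤ C * ‖x‖ ^ 3) (y : V) :
    Tendsto (fun s : ℝ => (((s ^ 2)⁻¹ : ℝ) : ℂ) * r (s • y)) (𝓝[>] 0) (𝓝 0) := by
  have hsy : Tendsto (fun s : ℝ => ‖s • y‖) (𝓝[>] 0) (𝓝 0) := by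
    have : Continuous fun s : ℝ => ‖s • y‖ := by fun_prop
    simpa using (this.tendsto 0).mono_left nhdsWithin_le_nhds
  have hlim : Tendsto (fun s : ℝ => C * ‖y‖ ^ 3 * s) (𝓝[>] 0) (𝓝 0) := by
    have : Continuous fun s : ℝ => C * ‖y‖ ^ 3 * s := by fun_prop
    simpa using (this.tendsto 0).mono_left nhdsWithin_le_nhds
  refine squeeze_zero_norm' ?_ hlim
  filter_upwards [hsy.eventually_le_const hδ, self_mem_nhdsWithin] with s hs hs0
  have hs0 : 0 < s := hs0
  rw [norm_mul, Complex.norm_real, Real.norm_of_nonneg (by positivity)]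
  calc (s ^ 2)⁻¹ * ‖r (s • y)‖ ≤ (s ^ 2)⁻¹ * (C * ‖s • y‖ ^ 3) := by
        gcongr
        exact hr _ hs
    _ = C * ‖y‖ ^ 3 * s := by
        rw [norm_smul, Real.norm_of_nonneg hs0.le]
        field_simp

/-- The rescaled oscillatory integrals converge to the Gaussian integral. -/
theorem tendsto_integral_cutoff_mul_cexp {V : Type*} [NormedAddCommGroup V]
    [InnerProductSpace ℝ V] [FiniteDimensional ℝ V] [MeasurableSpace V] [BorelSpace V]
    {δ : ℝ} (hδ : 0 < δ) {χ : V → ℝ} (hχc : Continuous χ) (hχ01 : ∀ x, 0 ≤ χ x ∧ χ x ≤ 1)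
    (hχ1 : χ 0 = 1) (hχ0 : ∀ x, δ ≤ ‖x‖ → χ x = 0) {r : V → ℂ} (hrc : Continuous r) {C : ℝ}
    (hr : ∀ x, ‖x‖ ≤ δ → ‖r x‖ ≤ C * ‖x‖ ^ 3) (hCδ : C * δ ≤ 1) :
    Tendsto (fun s : ℝ => ∫ y : V, (χ (s • y) : ℂ) ^ 2 *
        Complex.exp (((s ^ 2)⁻¹ : ℝ) * (-2 * (‖s • y‖ : ℂ) ^ 2 + r (s • y))))
      (𝓝[>] 0) (𝓝 (∫ y : V, (Real.exp (-2 * ‖y‖ ^ 2) : ℂ))) := by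
  have hphase : ∀ s : ℝ, 0 < s → ∀ y : V,
      ((((s ^ 2)⁻¹ : ℝ) : ℂ) * (-2 * (‖s • y‖ : ℂ) ^ 2 + r (s • y))) =
        ((-2 * ‖y‖ ^ 2 : ℝ) : ℂ) + (((s ^ 2)⁻¹ : ℝ) : ℂ) * r (s • y) := by
    intro s hs y
    have : (s : ℂ) ≠ 0 := by exact_mod_cast hs.ne'
    rw [norm_smul, Real.norm_of_nonneg hs.le]
    push_cast
    field_simp
  refine tendsto_integral_filter_of_dominated_convergence
    (fun y => Real.exp (-1 * ‖y‖ ^ 2)) ?_ ?_ (integrable_exp_neg_mul_sq_norm one_pos) ?_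
  · refine Eventually.of_forall fun s => Continuous.aestronglyMeasurable ?_
    fun_prop
  · filter_upwards [self_mem_nhdsWithin] with s hs
    have hs : 0 < s := hs
    refine Eventually.of_forall fun y => ?_
    rcases le_total δ ‖s • y‖ with h | h
    · simpa [hχ0 _ h] using Real.exp_nonneg _
    · have hχ : ‖(χ (s • y) : ℂ) ^ 2‖ ≤ 1 := by
        rw [norm_pow, Complex.norm_real, Real.norm_of_nonneg (hχ01 _).1]
        exact pow_le_one₀ (hχ01 _).1 (hχ01 _).2
      have hrem : ‖(((s ^ 2)⁻¹ : ℝ) : ℂ) * r (s • y)‖ ≤ ‖y‖ ^ 2 := by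
        rw [norm_mul, Complex.norm_real, Real.norm_of_nonneg (by positivity)]
        have := norm_le_sq_of_le_cube hr hCδ h
        rw [norm_smul s y, Real.norm_of_nonneg hs.le, mul_pow] at this
        rwa [inv_mul_le_iff₀ (by positivity)]
      rw [hphase s hs, norm_mul, Complex.norm_exp]
      refine (mul_le_of_le_one_left (Real.exp_nonneg _) hχ).trans (Real.exp_le_exp.2 ?_)
      rw [Complex.add_re, Complex.ofReal_re]
      linarith [Complex.re_le_norm ((((s ^ 2)⁻¹ : ℝ) : ℂ) * r (s • y))]
  · refine Eventually.of_forall fun y => ?_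
    have hχ : Tendsto (fun s : ℝ => (χ (s • y) : ℂ) ^ 2) (𝓝[>] 0) (𝓝 1) := by
      have : Continuous fun s : ℝ => (χ (s • y) : ℂ) ^ 2 := by fun_prop
      simpa [hχ1] using (this.tendsto 0).mono_left nhdsWithin_le_nhds
    have hexp := ((tendsto_inv_sq_mul_comp_smul hδ hr y).const_add
      ((-2 * ‖y‖ ^ 2 : ℝ) : ℂ)).cexp
    rw [add_zero] at hexp
    have hmul := hχ.mul hexp
    rw [one_mul, ← Complex.ofReal_exp] at hmul
    refine hmul.congr' ?_
    filter_upwards [self_mem_nhdsWithin] with s hs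
    rw [hphase s hs]

/-- Complex-phase Gaussian lower bound: with a cut-off `χ` equal to `1` on `‖x‖ ≤ δ₀` and
supported in `‖x‖ ≤ δ`, and a continuous complex perturbation `r` with `|r x| ≤ C‖x‖³` for
`‖x‖ ≤ δ` and `Cδ ≤ 1`, there are `c > 0` and `λ₀ ≥ 1` such that
`|∫ χ² e^{λ(-2‖x‖² + r(x))} dx| ≥ c λ^{-d/2}` for all `λ ≥ λ₀`. -/
theorem stmt_7 (d : ℕ) (hd : 1 ≤ d) (δ δ₀ : ℝ) (hδ₀ : 0 < δ₀) (hδ : δ₀ ≤ δ)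
    (χ : EuclideanSpace ℝ (Fin d) → ℝ) (hχc : Continuous χ)
    (hχ01 : ∀ x, 0 ≤ χ x ∧ χ x ≤ 1)
    (hχ1 : ∀ x : EuclideanSpace ℝ (Fin d), ‖x‖ ≤ δ₀ → χ x = 1)
    (hχ0 : ∀ x : EuclideanSpace ℝ (Fin d), δ ≤ ‖x‖ → χ x = 0)
    (r : EuclideanSpace ℝ (Fin d) → ℂ) (hrc : Continuous r)
    (C : ℝ) (hr : ∀ x : EuclideanSpace ℝ (Fin d), ‖x‖ ≤ δ → ‖r x‖ ≤ C * ‖x‖ ^ 3)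
    (hCδ : C * δ ≤ 1) :
    ∃ c > (0 : ℝ), ∃ lam₀ ≥ (1 : ℝ), ∀ lam : ℝ, lam₀ ≤ lam →
      c * lam ^ (-(d : ℝ) / 2) ≤
        ‖∫ x : EuclideanSpace ℝ (Fin d),
            (χ x : ℂ) ^ 2 * Complex.exp (lam * (-2 * (‖x‖ : ℂ) ^ 2 + r x))‖ := by
  have hδpos : 0 < δ := hδ₀.trans_le hδ
  have hlim := tendsto_integral_cutoff_mul_cexp hδpos hχc hχ01
    (hχ1 0 (by simpa using hδ₀.le)) hχ0 hrc hr hCδ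
  set G : ℝ := ∫ y : EuclideanSpace ℝ (Fin d), Real.exp (-2 * ‖y‖ ^ 2) with hG
  have hGpos : 0 < G := by
    rw [hG, GaussianFourier.integral_rexp_neg_mul_sq_norm two_pos]
    positivity
  rw [integral_complex_ofReal, ← hG] at hlim
  have hscale : Tendsto (fun lam : ℝ => (√lam)⁻¹) atTop (𝓝[>] 0) :=
    tendsto_inv_atTop_nhdsGT_zero.comp Real.tendsto_sqrt_atTop
  have hnorm := (hlim.comp hscale).norm
  rw [Complex.norm_real, Real.norm_of_nonneg hGpos.le] at hnorm
  obtain ⟨L, hL⟩ := eventually_atTop.1 (hnorm.eventually_const_le (half_lt_self hGpos))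
  refine ⟨G / 2, half_pos hGpos, max L 1, le_max_right _ _, fun lam hlam => ?_⟩
  have hlam0 : 0 < lam := one_pos.trans_le ((le_max_right _ _).trans hlam)
  have hs : 0 < (√lam)⁻¹ := by positivity
  have hsq : (((√lam)⁻¹) ^ 2)⁻¹ = lam := by rw [inv_pow, inv_inv, Real.sq_sqrt hlam0.le]
  have hpow : ((√lam)⁻¹) ^ d = lam ^ (-(d : ℝ) / 2) := by
    rw [Real.sqrt_eq_rpow, ← Real.rpow_neg hlam0.le, ← Real.rpow_mul_natCast hlam0.le]
    congr 1
    ring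
  have hbound := hL lam ((le_max_left _ _).trans hlam)
  simp only [Function.comp_apply, hsq] at hbound
  rw [integral_eq_pow_smul_integral_comp_smul volume _ hs, finrank_euclideanSpace_fin, norm_smul,
    Real.norm_of_nonneg (by positivity), hpow, mul_comm (G / 2)]
  gcongr
end

section
/- Let d ≥ 1, let U ⊆ ℝ^d be an open neighborhood of 0, let φ : U → ℂ be smooth with Re φ(x) ≤ -(1/2)‖x‖² for all x ∈ U, and let h : U → ℂ be smooth with all of its iterated derivatives at 0 equal to zero. Let κ ⊆ U be compact. Then for every m ∈ ℕ and every N ∈ ℕ there is a constant C > 0 such that for all λ ≥ 1 and all x ∈ κ, the m-th iterated derivative of the function y ↦ h(y)·exp(λ φ(y)) satisfies ‖D^m(h · e^{λφ})(x)‖ ≤ C λ^{-N}. -/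
open Filter Topology Asymptotics

section RapidDecrease

variable {E F : Type*} [NormedAddCommGroup E] [NormedSpace ℝ E]
  [NormedAddCommGroup F] [NormedSpace ℝ F]

theorem ContDiffOn.continuousOn_iteratedFDeriv_of_isOpen {f : E → F} {U : Set E}
    (hf : ContDiffOn ℝ (⊤ : ℕ∞) f U) (hU : IsOpen U) (n : ℕ) :
    ContinuousOn (iteratedFDeriv ℝ n f) U :=
  (hf.continuousOn_iteratedFDerivWithin (m := n) (by exact_mod_cast le_top)
    hU.uniqueDiffOn).congr fun _ hx => (iteratedFDerivWithin_of_isOpen n hU hx).symm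

/-- All derivatives of a smooth function which is flat at `0` vanish to infinite order at `0`. -/
theorem iteratedFDeriv_isBigO_pow_of_flat {f : E → F} {U : Set E} (hU : IsOpen U)
    (h0 : (0 : E) ∈ U) (hf : ContDiffOn ℝ (⊤ : ℕ∞) f U)
    (hflat : ∀ m : ℕ, iteratedFDeriv ℝ m f 0 = 0) (M i : ℕ) :
    iteratedFDeriv ℝ i f =O[𝓝 0] fun x => ‖x‖ ^ M := by
  induction M generalizing i with
  | zero =>
    simp only [pow_zero]
    exact ((hf.continuousOn_iteratedFDeriv_of_isOpen hU i).continuousAt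
      (hU.mem_nhds h0)).tendsto.isBigO_one ℝ
  | succ M ih =>
    obtain ⟨C, hC, hb⟩ := (ih (i + 1)).exists_pos
    obtain ⟨r, hr, hball⟩ := Metric.eventually_nhds_iff_ball.1
      (hb.bound.and (hU.eventually_mem h0))
    refine IsBigO.of_bound C ?_
    filter_upwards [Metric.ball_mem_nhds 0 hr] with x hx
    have hsub : ∀ y ∈ Metric.closedBall (0 : E) ‖x‖, y ∈ Metric.ball (0 : E) r := by
      intro y hy
      simp only [mem_closedBall_zero_iff, mem_ball_zero_iff] at *
      linarith
    have hdiff : ∀ y ∈ Metric.closedBall (0 : E) ‖x‖,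
        DifferentiableAt ℝ (iteratedFDeriv ℝ i f) y := fun y hy =>
      (hf.contDiffAt (hU.mem_nhds (hball y (hsub y hy)).2)).differentiableAt_iteratedFDeriv
        (by exact_mod_cast ENat.natCast_lt_top i)
    have hbound : ∀ y ∈ Metric.closedBall (0 : E) ‖x‖,
        ‖fderiv ℝ (iteratedFDeriv ℝ i f) y‖ ≤ C * ‖x‖ ^ M := by
      intro y hy
      rw [norm_fderiv_iteratedFDeriv]
      refine (hball y (hsub y hy)).1.trans ?_
      rw [norm_pow, norm_norm]
      gcongr
      exact mem_closedBall_zero_iff.1 hy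
    have := (convex_closedBall (0 : E) ‖x‖).norm_image_sub_le_of_norm_fderiv_le hdiff hbound
      (x := 0) (y := x) (by simp) (by simp)
    rw [hflat, sub_zero, sub_zero] at this
    rw [norm_pow, norm_norm, pow_succ, ← mul_assoc]
    exact this

theorem exists_iteratedFDeriv_le_pow_of_flat {f : E → F} {U : Set E} (hU : IsOpen U)
    (h0 : (0 : E) ∈ U) (hf : ContDiffOn ℝ (⊤ : ℕ∞) f U)
    (hflat : ∀ m : ℕ, iteratedFDeriv ℝ m f 0 = 0) {κ : Set E} (hκ : IsCompact κ)
    (hκU : κ ⊆ U) (M i : ℕ) :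
    ∃ C ≥ (0 : ℝ), ∀ x ∈ κ, ‖iteratedFDeriv ℝ i f x‖ ≤ C * ‖x‖ ^ M := by
  obtain ⟨C, hC, hb⟩ := (iteratedFDeriv_isBigO_pow_of_flat hU h0 hf hflat M i).exists_pos
  obtain ⟨r, hr, hball⟩ := Metric.eventually_nhds_iff_ball.1 hb.bound
  obtain ⟨B, hB⟩ := hκ.exists_bound_of_continuousOn
    ((hf.continuousOn_iteratedFDeriv_of_isOpen hU i).mono hκU)
  refine ⟨C + |B| / r ^ M, by positivity, fun x hx => ?_⟩
  by_cases hxr : x ∈ Metric.ball (0 : E) r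
  · have h1 := hball x hxr
    rw [norm_pow, norm_norm] at h1
    refine h1.trans ?_
    gcongr
    exact le_add_of_nonneg_right (by positivity)
  · have hrx : r ≤ ‖x‖ := by simpa using hxr
    calc ‖iteratedFDeriv ℝ i f x‖ ≤ |B| := (hB x hx).trans (le_abs_self B)
      _ = |B| / r ^ M * r ^ M := by field_simp
      _ ≤ (C + |B| / r ^ M) * ‖x‖ ^ M := by
        gcongr
        exact le_add_of_nonneg_left hC.le

theorem Complex.norm_iteratedFDeriv_exp (n : ℕ) (w : ℂ) :
    ‖iteratedFDeriv ℝ n Complex.exp w‖ =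
      Real.exp w.re * ‖iteratedFDeriv ℝ n Complex.exp 0‖ := by
  have hexp : Complex.exp = fun z => Complex.exp w • Complex.exp (z - w) := by
    ext z
    rw [smul_eq_mul, ← Complex.exp_add, add_sub_cancel]
  have hshift : ContDiff ℝ n fun z => Complex.exp (z - w) :=
    (contDiff_id.sub contDiff_const).cexp
  conv_lhs => rw [hexp]
  rw [iteratedFDeriv_const_smul_apply' hshift.contDiffAt, iteratedFDeriv_comp_sub, sub_self, norm_smul (Complex.exp w), Complex.norm_exp]

/-- The derivatives of order at most `m` of `e^{λφ}` are bounded on a compact set by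
`λ ^ m * e^{λ Re φ}` up to a constant. -/
theorem exists_iteratedFDeriv_cexp_mul_le {φ : E → ℂ} {U : Set E} (hU : IsOpen U)
    (hφ : ContDiffOn ℝ (⊤ : ℕ∞) φ U) {κ : Set E} (hκ : IsCompact κ) (hκU : κ ⊆ U) (m : ℕ) :
    ∃ A ≥ (0 : ℝ), ∀ n ≤ m, ∀ lam : ℝ, 1 ≤ lam → ∀ x ∈ κ,
      ‖iteratedFDeriv ℝ n (fun y => Complex.exp (lam * φ y)) x‖ ≤
        A * lam ^ m * Real.exp (lam * (φ x).re) := by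
  choose B hB using fun i => hκ.exists_bound_of_continuousOn
    ((hφ.continuousOn_iteratedFDeriv_of_isOpen hU i).mono hκU)
  set D : ℝ := 1 + ∑ i ∈ Finset.range (m + 1), |B i| with hD
  set K : ℝ := ∑ i ∈ Finset.range (m + 1), ‖iteratedFDeriv ℝ i Complex.exp 0‖ with hK
  have hD1 : 1 ≤ D := le_add_of_nonneg_right (by positivity)
  have hK0 : 0 ≤ K := by positivity
  refine ⟨m.factorial * K * D ^ m, by positivity, fun n hn lam hlam x hx => ?_⟩
  have hxU := hκU hx
  have hinner : ContDiffOn ℝ (⊤ : ℕ∞) (fun y => lam • φ y) U := hφ.const_smul lam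
  have hcomp := norm_iteratedFDerivWithin_comp_le (n := n) (N := (⊤ : ℕ∞)) (x := x)
    (C := K * Real.exp (lam * (φ x).re)) (D := lam * D)
    (Complex.contDiff_exp (𝕜 := ℝ)).contDiffOn hinner (by exact_mod_cast le_top)
    uniqueDiffOn_univ hU.uniqueDiffOn (Set.mapsTo_univ _ _) hxU
    (fun i hi => by
      rw [iteratedFDerivWithin_univ, Complex.norm_iteratedFDeriv_exp, mul_comm]
      gcongr
      · exact Finset.single_le_sum (f := fun i => ‖iteratedFDeriv ℝ i Complex.exp (0 : ℂ)‖)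
          (fun _ _ => norm_nonneg _) (Finset.mem_range.2 (by omega))
      · simp)
    (fun i hi1 hi => by
      rw [iteratedFDerivWithin_of_isOpen i hU hxU, iteratedFDeriv_const_smul_apply'
        ((hφ.contDiffAt (hU.mem_nhds hxU)).of_le (by exact_mod_cast le_top)),
        norm_smul lam, Real.norm_of_nonneg (by linarith)]
      have hBD : ‖iteratedFDeriv ℝ i φ x‖ ≤ D := by
        refine ((hB i x hx).trans (le_abs_self _)).trans ?_
        refine (Finset.single_le_sum (f := fun i => |B i|) (fun _ _ => abs_nonneg _)
          (Finset.mem_range.2 (by omega : i < m + 1))).trans ?_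
        linarith
      calc lam * ‖iteratedFDeriv ℝ i φ x‖ ≤ lam * D := by gcongr
        _ ≤ (lam * D) ^ i := le_self_pow₀ (one_le_mul_of_one_le_of_one_le hlam hD1) (by omega))
  rw [iteratedFDerivWithin_of_isOpen n hU hxU] at hcomp
  have heq : (Complex.exp ∘ fun y => lam • φ y) = fun y => Complex.exp (lam * φ y) := by
    ext y
    simp
  rw [heq] at hcomp
  refine hcomp.trans ?_
  have hfac : (n.factorial : ℝ) ≤ m.factorial := by exact_mod_cast Nat.factorial_le hn
  have hpow : (lam * D) ^ n ≤ (lam * D) ^ m :=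
    pow_le_pow_right₀ (one_le_mul_of_one_le_of_one_le hlam hD1) hn
  calc (n.factorial : ℝ) * (K * Real.exp (lam * (φ x).re)) * (lam * D) ^ n
      ≤ m.factorial * (K * Real.exp (lam * (φ x).re)) * (lam * D) ^ m := by gcongr
    _ = _ := by rw [mul_pow]; ring

theorem Real.pow_mul_exp_neg_half_le {t : ℝ} (ht : 0 ≤ t) (M : ℕ) :
    t ^ M * Real.exp (-(1 / 2) * t) ≤ 2 ^ M * M.factorial := by
  have h1 := Real.pow_div_factorial_le_exp (x := t / 2) (by positivity) M
  rw [div_le_iff₀ (by positivity), div_pow, div_le_iff₀ (by positivity)] at h1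
  calc t ^ M * Real.exp (-(1 / 2) * t)
      ≤ (Real.exp (t / 2) * M.factorial * 2 ^ M) * Real.exp (-(1 / 2) * t) := by gcongr
    _ = (Real.exp (t / 2) * Real.exp (-(1 / 2) * t)) * (2 ^ M * M.factorial) := by ring
    _ = 2 ^ M * M.factorial := by
      rw [← Real.exp_add]; ring_nf; simp

end RapidDecrease


/-- Rapid decrease of derivatives of `h · e^{λφ}`: if `φ` is smooth on an open
neighborhood `U` of `0` with `Re φ(x) ≤ -(1/2)‖x‖²` on `U`, and `h` is smooth on `U` with
all iterated derivatives at `0` equal to zero, then on any compact `κ ⊆ U`, for every `m`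
and `N` there is `C > 0` such that `‖D^m(h e^{λφ})(x)‖ ≤ C λ^{-N}` for all `λ ≥ 1`,
`x ∈ κ`. -/
theorem stmt_9 (d : ℕ) (hd : 1 ≤ d)
    (U : Set (EuclideanSpace ℝ (Fin d))) (hU : IsOpen U)
    (h0 : (0 : EuclideanSpace ℝ (Fin d)) ∈ U)
    (φ : EuclideanSpace ℝ (Fin d) → ℂ) (hφ : ContDiffOn ℝ (⊤ : ℕ∞) φ U)
    (hre : ∀ x ∈ U, (φ x).re ≤ -(1 / 2) * ‖x‖ ^ 2)
    (h : EuclideanSpace ℝ (Fin d) → ℂ) (hh : ContDiffOn ℝ (⊤ : ℕ∞) h U)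
    (hflat : ∀ m : ℕ, iteratedFDeriv ℝ m h 0 = 0)
    (κ : Set (EuclideanSpace ℝ (Fin d))) (hκ : IsCompact κ) (hκU : κ ⊆ U) :
    ∀ m N : ℕ, ∃ C > (0 : ℝ), ∀ lam : ℝ, 1 ≤ lam → ∀ x ∈ κ,
      ‖iteratedFDeriv ℝ m (fun y => h y * Complex.exp (lam * φ y)) x‖ ≤
        C * lam ^ (-(N : ℝ)) := by
  intro m N
  choose H hH0 hH using exists_iteratedFDeriv_le_pow_of_flat hU h0 hh hflat hκ hκU
    (2 * (m + N))
  obtain ⟨A, hA0, hA⟩ := exists_iteratedFDeriv_cexp_mul_le hU hφ hκ hκU m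
  set S : ℝ := ∑ i ∈ Finset.range (m + 1), (m.choose i : ℝ) * H i * A with hS
  have hS0 : 0 ≤ S := Finset.sum_nonneg fun i _ => by
    have := hH0 i
    positivity
  set T : ℝ := 2 ^ (m + N) * (m + N).factorial with hT
  refine ⟨S * T + 1, by positivity, fun lam hlam x hx => ?_⟩
  have hlam0 : 0 < lam := by linarith
  have hxU := hκU hx
  have hexp : ContDiffOn ℝ (⊤ : ℕ∞) (fun y => Complex.exp (lam * φ y)) U :=
    (contDiffOn_const.mul hφ).cexp
  have hprod := norm_iteratedFDerivWithin_mul_le hh hexp hU.uniqueDiffOn hxU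
    (n := m) (by exact_mod_cast le_top)
  simp only [iteratedFDerivWithin_of_isOpen _ hU hxU] at hprod
  have hgauss : Real.exp (lam * (φ x).re) ≤ Real.exp (-(1 / 2) * (lam * ‖x‖ ^ 2)) := by
    rw [Real.exp_le_exp]
    nlinarith [hre x hxU]
  calc _ ≤ _ := hprod
    _ ≤ ∑ i ∈ Finset.range (m + 1), (m.choose i : ℝ) * (H i * ‖x‖ ^ (2 * (m + N))) *
          (A * lam ^ m * Real.exp (-(1 / 2) * (lam * ‖x‖ ^ 2))) := by
      gcongr with i hi
      · have := hH0 i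
        positivity
      · exact hH i x hx
      · exact (hA (m - i) (Nat.sub_le _ _) lam hlam x hx).trans (by gcongr)
    _ = S * (‖x‖ ^ (2 * (m + N)) * lam ^ m * Real.exp (-(1 / 2) * (lam * ‖x‖ ^ 2))) := by
      rw [hS, Finset.sum_mul]
      exact Finset.sum_congr rfl fun i _ => by ring
    _ = S * ((lam * ‖x‖ ^ 2) ^ (m + N) * Real.exp (-(1 / 2) * (lam * ‖x‖ ^ 2))) *
          lam ^ (-(N : ℝ)) := by
      rw [Real.rpow_neg hlam0.le, Real.rpow_natCast, mul_pow, ← pow_mul, pow_add lam]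
      field_simp
    _ ≤ S * T * lam ^ (-(N : ℝ)) := by
      gcongr
      exact Real.pow_mul_exp_neg_half_le (by positivity) _
    _ ≤ (S * T + 1) * lam ^ (-(N : ℝ)) := by
      gcongr
      linarith
end
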